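/- arXiv:2602.13174 — 2 statements merged into one kernel-verified Lean document; each statement's English description precedes it below -/
import Mathlib

section
/- Suppose W, V : ℝ → ℝ are L-periodic and twice continuously differentiable, and u : ℝ → ℝ is twice continuously differentiable, L-periodic, strictly positive, with ∫_Ω u dx = 1. If u solves the stationary equation d/dx(σ u'(x) + κ u(x) (W*u)'(x) + u(x) V'(x)) = 0 for all x ∈ ℝ, then u = T u. (In particular, together with the converse implication, stationary states of the aggregation–diffusion equation coincide exactly with fixed points of the map T.) -/
open MeasureTheory Real Set

/-- Periodic convolution over Ω = (-L/2, L/2]: `(W*u)(x) = ∫_Ω W(x-y) u(y) dy`. -/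
noncomputable def pconv (L : ℝ) (W u : ℝ → ℝ) (x : ℝ) : ℝ :=
  ∫ y in Set.Ioc (-(L/2)) (L/2), W (x - y) * u y

/-- Normalisation constant `Z(u)`. -/
noncomputable def Zfun (L σ κ : ℝ) (W V u : ℝ → ℝ) : ℝ :=
  ∫ y in Set.Ioc (-(L/2)) (L/2), Real.exp (-σ⁻¹ * (κ * pconv L W u y + V y))

/-- The fixed-point map `T`. -/
noncomputable def Tmap (L σ κ : ℝ) (W V u : ℝ → ℝ) (x : ℝ) : ℝ :=
  Real.exp (-σ⁻¹ * (κ * pconv L W u x + V x)) / Zfun L σ κ W V u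

/-- Differentiation under the integral sign for the periodic convolution. -/
theorem hasDerivAt_pconv {L : ℝ} {W u : ℝ → ℝ} (hW : ContDiff ℝ 1 W) (hu : Continuous u)
    (x : ℝ) : HasDerivAt (pconv L W u) (pconv L (deriv W) u x) x := by
  have hW' : Continuous (deriv W) := hW.continuous_deriv le_rfl
  have hcont : ∀ {f : ℝ → ℝ}, Continuous f → ∀ z, Continuous fun y => f (z - y) * u y := by
    intro f hf z
    fun_prop
  have hK : IsCompact (Icc (x - 1) (x + 1) ×ˢ Icc (-(L / 2)) (L / 2)) :=
    isCompact_Icc.prod isCompact_Icc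
  obtain ⟨C, hC⟩ := hK.exists_bound_of_continuousOn
    (f := fun p : ℝ × ℝ => deriv W (p.1 - p.2) * u p.2) (by fun_prop)
  refine (hasDerivAt_integral_of_dominated_loc_of_deriv_le
    (μ := volume.restrict (Ioc (-(L / 2)) (L / 2)))
    (F := fun z y => W (z - y) * u y) (F' := fun z y => deriv W (z - y) * u y)
    (bound := fun _ => C) (s := Icc (x - 1) (x + 1))
    (Icc_mem_nhds (by linarith) (by linarith)) ?_ ?_ ?_ ?_ ?_ ?_).2
  · exact .of_forall fun z => (hcont hW.continuous z).aestronglyMeasurable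
  · exact (hcont hW.continuous x).integrableOn_Ioc
  · exact (hcont hW' x).aestronglyMeasurable
  · refine (ae_restrict_iff' measurableSet_Ioc).2 (.of_forall fun y hy z hz => ?_)
    exact hC (z, y) ⟨hz, Ioc_subset_Icc_self hy⟩
  · exact continuous_const.integrableOn_Ioc
  · refine .of_forall fun y z _ => ?_
    have hd := ((hW.differentiable one_ne_zero) (z - y)).hasDerivAt
    simpa using (hd.comp_sub_const z y).mul_const (u y)

theorem pconv_periodic {L : ℝ} {W : ℝ → ℝ} (hW : Function.Periodic W L) (u : ℝ → ℝ) :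
    Function.Periodic (pconv L W u) L := by
  intro x
  simp only [pconv, add_sub_right_comm, hW _]

/-- A periodic function whose derivative is a constant divided by a positive function is
constant. -/
theorem Function.Periodic.eq_of_hasDerivAt_const_div {L c : ℝ} (hL : 0 < L) {φ u : ℝ → ℝ}
    (hφ : Function.Periodic φ L) (hu : ∀ x, 0 < u x)
    (hd : ∀ x, HasDerivAt φ (c / u x) x) (x y : ℝ) : φ x = φ y := by
  obtain ⟨z, -, hz⟩ := exists_hasDerivAt_eq_zero (f := φ) hL
    (fun x _ => (hd x).continuousAt.continuousWithinAt) (by simpa using (hφ 0).symm)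
    (fun x _ => hd x)
  have hc : c = 0 := (div_eq_zero_iff.1 hz).resolve_right (hu z).ne'
  refine is_const_of_deriv_eq_zero (fun x => (hd x).differentiableAt) (fun x => ?_) x y
  simpa [hc] using (hd x).deriv

/-- If `W, V` are L-periodic and C², and `u` is C², L-periodic, strictly
positive, with unit mass, and solves the stationary equation
`d/dx(σ u' + κ u (W*u)' + u V') = 0`, then `u` is a fixed point of `T`. -/
theorem stationary_is_fixedPoint (L σ κ : ℝ) (hL : 0 < L) (hσ : 0 < σ) (hκ : 0 ≤ κ)
    (W V : ℝ → ℝ) (hW : ContDiff ℝ 2 W) (hWper : Function.Periodic W L)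
    (hV : ContDiff ℝ 2 V) (hVper : Function.Periodic V L)
    (u : ℝ → ℝ) (hu : ContDiff ℝ 2 u) (huper : Function.Periodic u L)
    (hupos : ∀ x : ℝ, 0 < u x)
    (humass : (∫ x in Set.Ioc (-(L/2)) (L/2), u x) = 1)
    (hstat : ∀ x : ℝ,
      deriv (fun y => σ * deriv u y + κ * u y * deriv (pconv L W u) y + u y * deriv V y) x = 0) :
    u = Tmap L σ κ W V u := by
  have contDiff_deriv : ∀ {f : ℝ → ℝ}, ContDiff ℝ 2 f → ContDiff ℝ 1 (deriv f) :=
    fun hf => hf.deriv' (n := 1)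
  have hud : Differentiable ℝ u := hu.differentiable two_ne_zero
  have hVd : Differentiable ℝ V := hV.differentiable two_ne_zero
  have hu'd : Differentiable ℝ (deriv u) := (contDiff_deriv hu).differentiable one_ne_zero
  have hV'd : Differentiable ℝ (deriv V) := (contDiff_deriv hV).differentiable one_ne_zero
  have hP := hasDerivAt_pconv (L := L) (hW.of_le one_le_two) hu.continuous
  have hP'd : Differentiable ℝ (deriv (pconv L W u)) := by
    rw [show deriv (pconv L W u) = pconv L (deriv W) u from funext fun x => (hP x).deriv]
    exact fun x => (hasDerivAt_pconv (contDiff_deriv hW) hu.continuous x).differentiableAt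
  have hflux := is_const_of_deriv_eq_zero (by fun_prop) hstat
  set φ : ℝ → ℝ := fun x => σ * log (u x) + κ * pconv L W u x + V x with hφ
  have hφper : Function.Periodic φ L := fun x => by
    simp only [hφ, huper x, pconv_periodic hWper u x, hVper x]
  have hφd : ∀ x, HasDerivAt φ
      ((σ * deriv u 0 + κ * u 0 * deriv (pconv L W u) 0 + u 0 * deriv V 0) / u x) x := by
    intro x
    refine (((((hud x).hasDerivAt.log (hupos x).ne').const_mul σ).add
      ((hP x).const_mul κ)).add (hVd x).hasDerivAt).congr_deriv ?_
    have := (hupos x).ne'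
    rw [hflux 0 x, (hP x).deriv]
    field_simp
  have hexp : ∀ x, u x =
      exp (σ⁻¹ * φ 0) * exp (-σ⁻¹ * (κ * pconv L W u x + V x)) := by
    intro x
    rw [hφper.eq_of_hasDerivAt_const_div hL hupos hφd 0 x, ← exp_add]
    have : σ⁻¹ * φ x + -σ⁻¹ * (κ * pconv L W u x + V x) = log (u x) := by
      simp only [hφ]
      field_simp
      ring
    rw [this, exp_log (hupos x)]
  have hZ : exp (σ⁻¹ * φ 0) * Zfun L σ κ W V u = 1 := by
    rw [Zfun, ← integral_const_mul, ← humass]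
    exact integral_congr_ae (.of_forall fun x => (hexp x).symm)
  funext x
  rw [Tmap, eq_div_iff (right_ne_zero_of_mul_eq_one hZ), hexp x, mul_right_comm, hZ, one_mul]
end

section
/- Let u : ℝ → ℝ be continuous, L-periodic and strictly positive, let η : ℝ → ℝ be continuous, L-periodic with ∫_Ω η dx = 0, and let W be even. Then the map ε ↦ F[u + εη] is differentiable at ε = 0 with derivative d/dε F[u + εη]|_{ε=0} = ∫_Ω η(x)(σ log u(x) + (W*u)(x) + V(x)) dx. -/
open MeasureTheory Real Set

/-- The free energy functional
`F[u] = ∫_Ω u (σ log u - 1 + ½ (W*u) + V) dx`. -/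
noncomputable def Fenergy (L σ : ℝ) (W V u : ℝ → ℝ) : ℝ :=
  ∫ x in Set.Ioc (-(L/2)) (L/2),
    u x * (σ * Real.log (u x) - 1 + (1/2) * pconv L W u x + V x)

/-- The periodic convolution of continuous functions is continuous. -/
lemma continuous_pconv {L : ℝ} (hL : 0 ≤ L) {W u : ℝ → ℝ} (hW : Continuous W)
    (hu : Continuous u) : Continuous (pconv L W u) := by
  have h : pconv L W u = fun x => ∫ y in (-(L/2))..(L/2), W (x - y) * u y := by
    funext x
    rw [intervalIntegral.integral_of_le (by linarith)]
    rfl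
  rw [h]
  exact intervalIntegral.continuous_parametric_intervalIntegral_of_continuous' (by fun_prop) _ _

/-- The periodic convolution is affine along lines. -/
lemma pconv_add_mul {L : ℝ} {W u η : ℝ → ℝ} (hW : Continuous W)
    (hu : Continuous u) (hη : Continuous η) (ε x : ℝ) :
    pconv L W (fun y => u y + ε * η y) x = pconv L W u x + ε * pconv L W η x := by
  unfold pconv
  rw [← integral_const_mul, ← integral_add]
  · congr 1
    funext y
    ring
  · exact Continuous.integrableOn_Ioc (by fun_prop)
  · exact Continuous.integrableOn_Ioc (by fun_prop)

/-- Convolution with an even continuous kernel is symmetric. -/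
lemma integral_mul_pconv_comm {L : ℝ} {W u η : ℝ → ℝ} (hW : Continuous W)
    (hWeven : ∀ x, W (-x) = W x) (hu : Continuous u) (hη : Continuous η) :
    ∫ x in Set.Ioc (-(L/2)) (L/2), u x * pconv L W η x =
      ∫ x in Set.Ioc (-(L/2)) (L/2), η x * pconv L W u x := by
  unfold pconv
  simp_rw [← integral_const_mul]
  rw [integral_integral_swap]
  · congr 1
    funext y
    congr 1
    funext x
    rw [← hWeven (x - y), neg_sub]
    ring
  · rw [Measure.prod_restrict]
    refine IntegrableOn.mono_set (t := Set.Icc (-(L/2)) (L/2) ×ˢ Set.Icc (-(L/2)) (L/2)) ?_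
      (Set.prod_mono Set.Ioc_subset_Icc_self Set.Ioc_subset_Icc_self)
    refine ContinuousOn.integrableOn_compact (isCompact_Icc.prod isCompact_Icc) ?_
    exact Continuous.continuousOn (by unfold Function.uncurry; fun_prop)

/-- A small perturbation of a positive continuous function stays positive on a compact set. -/
lemma exists_forall_pos_add_mul {K : Set ℝ} (hK : IsCompact K) {u η : ℝ → ℝ}
    (hu : Continuous u) (hη : Continuous η) (hpos : ∀ x, 0 < u x) :
    ∃ δ > 0, ∀ ε ∈ Set.Icc (-δ) δ, ∀ x ∈ K, 0 < u x + ε * η x := by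
  obtain ⟨C, hC⟩ := hK.exists_bound_of_continuousOn
    (f := fun x => η x / u x) (hη.div hu fun x => (hpos x).ne').continuousOn
  refine ⟨(|C| + 1)⁻¹, by positivity, fun ε hε x hx => ?_⟩
  have hC' : |η x / u x| ≤ |C| := (hC x hx).trans (le_abs_self C)
  have hlt : |ε * (η x / u x)| < 1 := by
    rw [abs_mul]
    calc |ε| * |η x / u x| ≤ (|C| + 1)⁻¹ * |C| :=
          mul_le_mul (abs_le.2 hε) hC' (abs_nonneg _) (by positivity)
      _ < 1 := by
          rw [inv_mul_lt_one₀ (by positivity)]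
          linarith
  have hfac : u x + ε * η x = u x * (1 + ε * (η x / u x)) := by
    have := (hpos x).ne'
    field_simp
  rw [hfac]
  exact mul_pos (hpos x) (by linarith [(abs_lt.1 hlt).1])

/-- Differentiation under the integral sign over a bounded interval, for an integrand whose
derivative in the parameter is jointly continuous. -/
lemma hasDerivAt_integral_Ioc_of_continuousOn {a b δ : ℝ} (hδ : 0 < δ) {f f' : ℝ → ℝ → ℝ}
    (hf : ∀ ε ∈ Set.Icc (-δ) δ, ContinuousOn (f ε) (Set.Icc a b))
    (hf' : ContinuousOn (Function.uncurry f') (Set.Icc (-δ) δ ×ˢ Set.Icc a b))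
    (hd : ∀ ε ∈ Set.Icc (-δ) δ, ∀ x ∈ Set.Icc a b, HasDerivAt (fun t => f t x) (f' ε x) ε) :
    HasDerivAt (fun ε => ∫ x in Set.Ioc a b, f ε x) (∫ x in Set.Ioc a b, f' 0 x) 0 := by
  obtain ⟨C, hC⟩ := (isCompact_Icc.prod isCompact_Icc).exists_bound_of_continuousOn hf'
  have hs : Set.Icc (-δ) δ ∈ nhds (0 : ℝ) := Icc_mem_nhds (by linarith) hδ
  have h0 : (0 : ℝ) ∈ Set.Icc (-δ) δ := mem_of_mem_nhds hs
  have hint {g : ℝ → ℝ} (hg : ContinuousOn g (Set.Icc a b)) : IntegrableOn g (Set.Ioc a b) :=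
    (hg.integrableOn_compact isCompact_Icc).mono_set Set.Ioc_subset_Icc_self
  refine (hasDerivAt_integral_of_dominated_loc_of_deriv_le (bound := fun _ => C) hs
    (Filter.eventually_of_mem hs fun ε hε => (hint (hf ε hε)).aestronglyMeasurable)
    (hint (hf 0 h0)) ?_ ?_ ?_ ?_).2
  · refine (hint ?_).aestronglyMeasurable
    exact hf'.comp (f := fun x => ((0 : ℝ), x)) (by fun_prop) fun x hx => ⟨h0, hx⟩
  · filter_upwards [ae_restrict_mem measurableSet_Ioc] with x hx ε hε
    exact hC (ε, x) ⟨hε, Set.Ioc_subset_Icc_self hx⟩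
  · exact integrable_const C
  · filter_upwards [ae_restrict_mem measurableSet_Ioc] with x hx ε hε
    exact hd ε hε x (Set.Ioc_subset_Icc_self hx)

/-- For `u` continuous, L-periodic, strictly positive, and `η` continuous,
L-periodic with zero mean, and `W` even, the map `ε ↦ F[u + εη]` is differentiable at
`ε = 0` with derivative `∫_Ω η (σ log u + W*u + V) dx`. -/
theorem energy_first_variation (L σ : ℝ) (hL : 0 < L) (hσ : 0 < σ)
    (W V : ℝ → ℝ) (hWc : Continuous W) (hWper : Function.Periodic W L)
    (hWeven : ∀ x : ℝ, W (-x) = W x)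
    (hVc : Continuous V) (hVper : Function.Periodic V L)
    (u : ℝ → ℝ) (huc : Continuous u) (huper : Function.Periodic u L)
    (hupos : ∀ x : ℝ, 0 < u x)
    (η : ℝ → ℝ) (hηc : Continuous η) (hηper : Function.Periodic η L)
    (hηmean : (∫ x in Set.Ioc (-(L/2)) (L/2), η x) = 0) :
    HasDerivAt (fun ε : ℝ => Fenergy L σ W V (fun x => u x + ε * η x))
      (∫ x in Set.Ioc (-(L/2)) (L/2),
        η x * (σ * Real.log (u x) + pconv L W u x + V x)) 0 := by
  have ha : Continuous (pconv L W u) := continuous_pconv hL.le hWc huc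
  have hb : Continuous (pconv L W η) := continuous_pconv hL.le hWc hηc
  obtain ⟨δ, hδ, hpos⟩ := exists_forall_pos_add_mul
    (isCompact_Icc (a := -(L/2)) (b := L/2)) huc hηc hupos
  have key := hasDerivAt_integral_Ioc_of_continuousOn (a := -(L/2)) (b := L/2) hδ
    (f := fun ε x => (u x + ε * η x) * (σ * Real.log (u x + ε * η x) - 1
      + (1/2) * (pconv L W u x + ε * pconv L W η x) + V x))
    (f' := fun ε x => η x * (σ * Real.log (u x + ε * η x) - 1
      + (1/2) * (pconv L W u x + ε * pconv L W η x) + V x)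
      + (u x + ε * η x) * (σ * (η x / (u x + ε * η x)) + (1/2) * pconv L W η x))
    ?_ ?_ ?_
  · have hlog : Continuous fun x => Real.log (u x) := huc.log fun x => (hupos x).ne'
    have hval : ∫ x in Set.Ioc (-(L/2)) (L/2), (η x * (σ * Real.log (u x + 0 * η x) - 1
        + (1/2) * (pconv L W u x + 0 * pconv L W η x) + V x)
        + (u x + 0 * η x) * (σ * (η x / (u x + 0 * η x)) + (1/2) * pconv L W η x)) =
        ∫ x in Set.Ioc (-(L/2)) (L/2), η x * (σ * Real.log (u x) + pconv L W u x + V x) := by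
      have hsplit : ∀ x, η x * (σ * Real.log (u x + 0 * η x) - 1
          + (1/2) * (pconv L W u x + 0 * pconv L W η x) + V x)
          + (u x + 0 * η x) * (σ * (η x / (u x + 0 * η x)) + (1/2) * pconv L W η x) =
          η x * (σ * Real.log (u x) + pconv L W u x + V x) + ((σ - 1) * η x
          + (1/2) * (u x * pconv L W η x - η x * pconv L W u x)) := by
        intro x
        have := (hupos x).ne'
        simp only [zero_mul, add_zero]
        field_simp
        ring
      simp_rw [hsplit]
      rw [integral_add (Continuous.integrableOn_Ioc (by fun_prop))
          (Continuous.integrableOn_Ioc (by fun_prop)),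
        integral_add (Continuous.integrableOn_Ioc (by fun_prop))
          (Continuous.integrableOn_Ioc (by fun_prop)),
        integral_const_mul, integral_const_mul,
        integral_sub (Continuous.integrableOn_Ioc (by fun_prop))
          (Continuous.integrableOn_Ioc (by fun_prop)),
        integral_mul_pconv_comm hWc hWeven huc hηc, hηmean]
      ring
    rw [← hval]
    simpa only [Fenergy, pconv_add_mul hWc huc hηc] using key
  · intro ε hε
    have hlog : ContinuousOn (fun x => Real.log (u x + ε * η x)) (Set.Icc (-(L/2)) (L/2)) :=
      ContinuousOn.log (by fun_prop) fun x hx => (hpos ε hε x hx).ne'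
    fun_prop
  · have hlog : ContinuousOn (fun p : ℝ × ℝ => Real.log (u p.2 + p.1 * η p.2))
        (Set.Icc (-δ) δ ×ˢ Set.Icc (-(L/2)) (L/2)) :=
      ContinuousOn.log (by fun_prop) fun p hp => (hpos p.1 hp.1 p.2 hp.2).ne'
    have hdiv : ContinuousOn (fun p : ℝ × ℝ => η p.2 / (u p.2 + p.1 * η p.2))
        (Set.Icc (-δ) δ ×ˢ Set.Icc (-(L/2)) (L/2)) :=
      ContinuousOn.div (by fun_prop) (by fun_prop) fun p hp => (hpos p.1 hp.1 p.2 hp.2).ne'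
    unfold Function.uncurry
    fun_prop
  · intro ε hε x hx
    have hline (c d : ℝ) : HasDerivAt (fun t : ℝ => c + t * d) d ε := by
      simpa using ((hasDerivAt_id ε).mul_const d).const_add c
    exact (hline _ _).mul ((((((hline _ _).log (hpos ε hε x hx).ne').const_mul σ).sub_const 1).add
      ((hline _ _).const_mul (1/2))).add_const (V x))
end
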